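/- arXiv:1710.07678 — 3 statements merged into one kernel-verified Lean document; each statement's English description precedes it below -/
import Mathlib

section
/- Unisolvence of the minimal P_m finite element on an interval (Theorem 2.5 of the paper in the case n = 1, valid for every order m): let m ≥ 0 be an integer, let a, b be real numbers with a < b, and let p be a real polynomial of degree ≤ m. Assume that (i) for every integer j with 0 ≤ j ≤ m − 1 and 2 ∣ (m − 1 − j), the j-th derivative of p vanishes at a and at b, and (ii) if m is even, ∫ₐᵇ p(x) dx = 0. Then p is the zero polynomial. -/
open MeasureTheory

open Polynomial in
/-- If `p` has degree at most `k + 1` and its `k`-th derivative, which is affine, vanishes at two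
distinct points, then `p` has degree less than `k`. -/
theorem Polynomial.degree_lt_of_iterate_derivative_eval_eq_zero {p : ℝ[X]} {k : ℕ} {a b : ℝ}
    (hab : a ≠ b) (hdeg : p.degree ≤ (k + 1 : ℕ)) (ha : (derivative^[k] p).eval a = 0)
    (hb : (derivative^[k] p).eval b = 0) : p.degree < k := by
  have hq : derivative^[k] p = 0 := by
    apply eq_zero_of_natDegree_lt_card_of_eval_eq_zero' _ {a, b} (by simp [ha, hb])
    rw [Finset.card_pair hab]
    have := natDegree_iterate_derivative p k
    have := natDegree_le_of_degree_le hdeg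
    omega
  rw [degree_lt_iff_coeff_zero]
  intro i hi
  obtain ⟨d, rfl⟩ := Nat.exists_eq_add_of_le' hi
  have hc := congrArg (coeff · d) hq
  simpa [coeff_iterate_derivative, Nat.descFactorial_eq_zero_iff_lt] using hc

/-- Unisolvence of the minimal `P_m` finite element on an interval (Theorem 2.5 for `n = 1`):
let `a < b` and let `p` be a real polynomial of degree at most `m`.  If all derivatives of
`p` of order `j` with `0 ≤ j ≤ m - 1` and `2 ∣ (m - 1 - j)` vanish at `a` and at `b`, and
moreover (when `m` is even) the integral of `p` over `[a, b]` vanishes, then `p = 0`. -/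
theorem unisolvence_Pm_interval (m : ℕ) (a b : ℝ) (hab : a < b)
    (p : Polynomial ℝ) (hdeg : p.degree ≤ (m : ℕ))
    (hderiv : ∀ j : ℕ, j + 1 ≤ m → 2 ∣ m - 1 - j →
      (Polynomial.derivative^[j] p).eval a = 0 ∧ (Polynomial.derivative^[j] p).eval b = 0)
    (hint : Even m → (∫ x in a..b, p.eval x) = 0) :
    p = 0 := by
  induction m using Nat.twoStepInduction with
  | zero =>
    rw [Polynomial.eq_C_of_degree_le_zero hdeg] at hint ⊢
    simpa [sub_eq_zero, hab.ne'] using hint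
  | one =>
    obtain ⟨ha, hb⟩ := hderiv 0 le_rfl (by simp)
    simpa using Polynomial.degree_lt_of_iterate_derivative_eval_eq_zero hab.ne hdeg ha hb
  | more m ih _ =>
    obtain ⟨ha, hb⟩ := hderiv (m + 1) le_rfl (by simp)
    have hlt := Polynomial.degree_lt_of_iterate_derivative_eval_eq_zero hab.ne hdeg ha hb
    refine ih ?_ (fun j hj hdvd => hderiv j (by omega) (by omega))
      (fun hm => hint (hm.add even_two))
    rw [Polynomial.degree_lt_iff_coeff_zero] at hlt
    exact (Polynomial.degree_le_iff_coeff_zero _ _).mpr fun i hi => hlt i (by exact_mod_cast hi)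
end

section
/- Lemma 2.1 of the paper: for all integers m ≥ 0 and n ≥ 1, the number of degrees of freedom of the P_m element equals the dimension of the shape function space; precisely, with L = ⌊m/(n+1)⌋ and M_l = m − (n+1)(L − l) for 0 ≤ l ≤ L, the quantity J^{(m,n)} := δ + Σ_{l=0}^{L} Σ_{k=1}^{min(n, M_l)} C(n+1, k) · C(M_l − 1, k − 1), where δ = 1 if (n+1) ∣ m and δ = 0 otherwise, equals the dimension (finrank over ℝ) of the space of polynomials in n variables over ℝ of total degree at most m. -/
open Finset in
theorem MvPolynomial.finrank_restrictTotalDegree (σ R : Type*) [Fintype σ] [CommRing R]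
    [Nontrivial R] (m : ℕ) :
    Module.finrank R (MvPolynomial.restrictTotalDegree σ R m) =
      (m + Fintype.card σ).choose (Fintype.card σ) := by
  classical
  let S : Finset (σ →₀ ℕ) := (range (m + 1)).biUnion fun i ↦ univ.finsuppAntidiag i
  have hS : {s : σ →₀ ℕ | (s.sum fun _ e ↦ e) ≤ m} = (S : Set (σ →₀ ℕ)) := by
    ext s
    simp [S, mem_finsuppAntidiag', -mem_finsuppAntidiag]
  have hcard : #S = (m + Fintype.card σ).choose (Fintype.card σ) := by
    rw [card_biUnion]
    · simp_rw [card_finsuppAntidiag_nat_eq_multichoose, card_univ]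
      exact Nat.sum_range_multichoose m _
    · intro i _ j _ hij
      refine disjoint_left.2 fun s hi hj ↦ hij ?_
      rw [mem_finsuppAntidiag] at hi hj
      exact hi.1.symm.trans hj.1
  rw [MvPolynomial.restrictTotalDegree, Module.finrank_eq_nat_card_basis
    (MvPolynomial.basisRestrictSupport R _), hS, ← hcard]
  simp

open Finset in
theorem Nat.sum_range_choose_succ_mul_choose (n M : ℕ) :
    ∑ j ∈ range (n + 1), (n + 1).choose (j + 1) * M.choose j = (M + 1 + n).choose n := by
  rw [show M + 1 + n = M + (n + 1) by lia, Nat.add_choose_eq,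
    Finset.Nat.sum_antidiagonal_eq_sum_range_succ_mk]
  refine sum_congr rfl fun j hj ↦ ?_
  have hj : j ≤ n := by simpa [Nat.lt_succ_iff] using hj
  rw [mul_comm, Nat.choose_symm_of_eq_add (show n + 1 = (j + 1) + (n - j) by lia)]

open Finset in
theorem Nat.sum_Icc_choose_mul_choose_add_choose (n M : ℕ) :
    (∑ k ∈ Icc 1 (min n (M + 1)), (n + 1).choose k * M.choose (k - 1)) + M.choose n =
      (M + 1 + n).choose n := by
  rw [← Nat.sum_range_choose_succ_mul_choose, sum_range_succ, Nat.choose_self, one_mul]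
  congr 1
  have hsub : Icc 1 (min n (M + 1)) ⊆ Icc 1 n := Icc_subset_Icc_right (min_le_left _ _)
  rw [sum_subset hsub, ← Ico_add_one_right_eq_Icc, sum_Ico_eq_sum_range]
  · simp [add_comm]
  · intro k hk hk'
    rw [mem_Icc] at hk hk'
    rw [Nat.choose_eq_zero_of_lt (show M < k - 1 by lia), mul_zero]

open Finset in
theorem Nat.sum_range_sum_Icc_choose_mul_choose (n r q : ℕ) (hr : r ≤ n) :
    (if r = 0 then 1 else 0) + ∑ l ∈ range (q + 1),
      ∑ k ∈ Icc 1 (min n (r + (n + 1) * l)),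
        (n + 1).choose k * (r + (n + 1) * l - 1).choose (k - 1) =
      (r + (n + 1) * q + n).choose n := by
  induction q with
  | zero =>
    obtain _ | r := r
    · simp
    · have h := Nat.sum_Icc_choose_mul_choose_add_choose n r
      rw [Nat.choose_eq_zero_of_lt (show r < n by lia)] at h
      simpa using h
  | succ q ih =>
    rw [sum_range_succ, ← add_assoc, ih,
      show r + (n + 1) * (q + 1) = r + (n + 1) * q + n + 1 by ring, Nat.add_sub_cancel, add_comm]
    exact Nat.sum_Icc_choose_mul_choose_add_choose n _


/-- Lemma 2.1 of the paper: for `m ≥ 0`, `n ≥ 1`, the number of degrees of freedom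
`J^{(m,n)} = δ + ∑_{l=0}^{L} ∑_{k=1}^{min(n, M_l)} C(n+1, k) * C(M_l - 1, k-1)`
(where `L = ⌊m / (n+1)⌋`, `M_l = m - (n+1)(L - l)`, and `δ = 1` if `(n+1) ∣ m`, else `0`)
equals the dimension of the space of polynomials in `n` variables of total degree
at most `m` over `ℝ`. -/
theorem dof_count_eq_finrank (m n : ℕ) (hn : 1 ≤ n) :
    ((if (n + 1) ∣ m then 1 else 0) +
      ∑ l ∈ Finset.range (m / (n + 1) + 1),
        ∑ k ∈ Finset.Icc 1 (min n (m - (n + 1) * (m / (n + 1) - l))),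
          (n + 1).choose k * (m - (n + 1) * (m / (n + 1) - l) - 1).choose (k - 1)) =
      Module.finrank ℝ (MvPolynomial.restrictTotalDegree (Fin n) ℝ m) := by
  have hM : ∀ l ∈ Finset.range (m / (n + 1) + 1),
      m - (n + 1) * (m / (n + 1) - l) = m % (n + 1) + (n + 1) * l := by
    intro l hl
    obtain ⟨d, hd⟩ := Nat.exists_eq_add_of_le (Finset.mem_range_succ_iff.1 hl)
    have hdiv := Nat.mod_add_div m (n + 1)
    rw [hd, mul_add] at hdiv
    rw [hd, Nat.add_sub_cancel_left]
    lia
  rw [MvPolynomial.finrank_restrictTotalDegree, Fintype.card_fin,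
    Finset.sum_congr rfl fun l hl ↦ by rw [hM l hl]]
  have h := Nat.sum_range_sum_Icc_choose_mul_choose n (m % (n + 1)) (m / (n + 1))
    (Nat.lt_succ_iff.1 (Nat.mod_lt m n.succ_pos))
  rw [Nat.mod_add_div] at h
  simpa only [Nat.dvd_iff_mod_eq_zero] using h
end

section
/- The combinatorial identity underlying Lemma 2.1 of the paper: for all integers m ≥ 0 and n ≥ 1, with L = ⌊m/(n+1)⌋ and M_l = m − (n+1)(L − l) for 0 ≤ l ≤ L, one has δ + Σ_{l=0}^{L} Σ_{k=1}^{min(n, M_l)} C(n+1, k) · C(M_l − 1, k − 1) = C(m + n, n), where δ = 1 if (n+1) ∣ m and δ = 0 otherwise. -/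
/-- Vandermonde's identity with one factor reflected. -/
theorem sum_range_choose_succ_mul_choose (a n : ℕ) :
    ∑ i ∈ Finset.range (n + 1), (n + 1).choose (i + 1) * a.choose i = (a + 1 + n).choose n := by
  rw [show a + 1 + n = a + (n + 1) by ring, Nat.add_choose_eq,
    Finset.Nat.sum_antidiagonal_eq_sum_range_succ_mk]
  refine Finset.sum_congr rfl fun i hi => ?_
  rw [Finset.mem_range] at hi
  rw [mul_comm, Nat.choose_symm_of_eq_add (show n + 1 = (i + 1) + (n - i) by omega)]

theorem sum_Icc_choose_mul_choose_add (a n : ℕ) :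
    ∑ k ∈ Finset.Icc 1 (min n (a + 1)), (n + 1).choose k * (a + 1 - 1).choose (k - 1) +
      a.choose n = (a + 1 + n).choose n := by
  have hext : ∑ k ∈ Finset.Icc 1 (min n (a + 1)), (n + 1).choose k * a.choose (k - 1) =
      ∑ k ∈ Finset.Ico 1 (n + 1), (n + 1).choose k * a.choose (k - 1) := by
    refine Finset.sum_subset (fun k hk => ?_) fun k hk hk' => ?_
    · simp only [Finset.mem_Icc, Finset.mem_Ico] at *
      omega
    · simp only [Finset.mem_Icc, Finset.mem_Ico] at *
      rw [Nat.choose_eq_zero_of_lt (show a < k - 1 by omega), mul_zero]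
  rw [Nat.add_sub_cancel, hext, Finset.sum_Ico_eq_sum_range,
    ← sum_range_choose_succ_mul_choose, Finset.sum_range_succ]
  simp [add_comm]


/-- The combinatorial identity underlying Lemma 2.1 of the paper: for `m ≥ 0`, `n ≥ 1`,
with `L = ⌊m / (n+1)⌋` and `M_l = m - (n+1) * (L - l)`,
`δ + ∑_{l=0}^{L} ∑_{k=1}^{min(n, M_l)} C(n+1, k) * C(M_l - 1, k-1) = C(m+n, n)`,
where `δ = 1` if `(n+1) ∣ m` and `δ = 0` otherwise. -/
theorem dof_count_eq_choose (m n : ℕ) (hn : 1 ≤ n) :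
    ((if (n + 1) ∣ m then 1 else 0) +
      ∑ l ∈ Finset.range (m / (n + 1) + 1),
        ∑ k ∈ Finset.Icc 1 (min n (m - (n + 1) * (m / (n + 1) - l))),
          (n + 1).choose k * (m - (n + 1) * (m / (n + 1) - l) - 1).choose (k - 1)) =
      (m + n).choose n := by
  induction m using Nat.strong_induction_on with
  | _ m ih =>
    rcases lt_or_ge m (n + 1) with h | h
    · rw [Nat.div_eq_of_lt h]
      rcases m with _ | a
      · simp
      · have hdvd : ¬ (n + 1) ∣ a + 1 := Nat.not_dvd_of_pos_of_lt a.succ_pos h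
        have key := sum_Icc_choose_mul_choose_add a n
        rw [Nat.choose_eq_zero_of_lt (show a < n by omega)] at key
        simpa [hdvd] using key
    · obtain ⟨b, rfl⟩ := Nat.exists_eq_add_of_le' h
      have hb := ih b (by omega)
      have key := sum_Icc_choose_mul_choose_add (b + n) n
      rw [Nat.add_div_right b n.succ_pos, Finset.sum_range_succ, Nat.succ_eq_add_one]
      have hsum : ∀ l ∈ Finset.range (b / (n + 1) + 1),
          b + (n + 1) - (n + 1) * (b / (n + 1) + 1 - l) = b - (n + 1) * (b / (n + 1) - l) := by
        intro l hl
        rw [Finset.mem_range] at hl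
        rw [Nat.sub_add_comm (Nat.lt_succ_iff.mp hl), mul_add, mul_one, Nat.add_sub_add_right]
      rw [Finset.sum_congr rfl fun l hl => by rw [hsum l hl], ← add_assoc]
      simp only [Nat.dvd_add_self_right, Nat.sub_self, mul_zero, Nat.sub_zero]
      rw [hb, add_comm]
      exact key
end
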